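/- arXiv:math/0410521 — 17 statements merged into one kernel-verified Lean document; each statement's English description precedes it below -/
import Mathlib

section
/- Let A be a ring that is right duo (for all f, r ∈ A there exists s ∈ A with r*f = f*s) and M a nonzero (A,A)-bimodule, and let R = TrivSqZeroExt A M. If R is right duo (for all f, r ∈ R there exists s ∈ R with r*f = f*s), then the set I = {a ∈ A | a • m = 0 for all m ∈ M} is a two-sided ideal of A, and every a ∈ I also annihilates M on the right: m • a = 0 for all m ∈ M. -/
/-- **Ore extensions over duo rings** (Matczuk), Lemma 2.1.
If `A` is right duo, `M` is a nonzero `(A,A)`-bimodule, and the square-zero corner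
extension `R = A ⊕ M = TrivSqZeroExt A M` is right duo, then the left annihilator
`I = {a : A | ∀ m, a • m = 0}` is a two-sided ideal of `A`, and every `a ∈ I` also
annihilates `M` on the right. -/
theorem leftAnnihilator_twoSided_of_rightDuo_trivSqZeroExt
    {A M : Type*} [Ring A] [AddCommGroup M] [Module A M] [Module Aᵐᵒᵖ M]
    [SMulCommClass A Aᵐᵒᵖ M]
    (hA : ∀ f r : A, ∃ s : A, r * f = f * s)
    (hM : ∃ m : M, m ≠ 0)
    (hR : ∀ f r : TrivSqZeroExt A M, ∃ s : TrivSqZeroExt A M, r * f = f * s) :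
    (∃ J : TwoSidedIdeal A, ∀ a : A, a ∈ J ↔ ∀ m : M, a • m = 0) ∧
    (∀ a : A, (∀ m : M, a • m = 0) → ∀ m : M, MulOpposite.op a • m = 0) := by
  refine ⟨⟨TwoSidedIdeal.mk' {a : A | ∀ m : M, a • m = 0} (fun m => zero_smul A m)
    (fun ha hb m => by rw [add_smul, ha m, hb m, add_zero])
    (fun ha m => by rw [neg_smul, ha m, neg_zero])
    (fun hb m => by rw [mul_smul, hb m, smul_zero])
    (fun ha m => by rw [mul_smul, ha]), fun a => ?_⟩, fun a ha m => ?_⟩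
  · simp [TwoSidedIdeal.mem_mk']
  · obtain ⟨s, hs⟩ := hR (TrivSqZeroExt.inl a) (TrivSqZeroExt.inr m)
    simpa [ha] using congrArg TrivSqZeroExt.snd hs
end

section
/- Let A be a right duo ring, M an (A,A)-bimodule, and R = TrivSqZeroExt A M. Suppose a ∈ A satisfies a • M = M (every m ∈ M equals a • m' for some m' ∈ M). Then for every m ∈ M, the principal right ideal generated by (a,m) satisfies {(a,m)*t | t ∈ R} = {(a*b, m') | b ∈ A, m' ∈ M}, and this set is a two-sided ideal of R (it is closed under left multiplication by arbitrary elements of R). -/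
/-- The element `(a, m)` of the square-zero extension `TrivSqZeroExt A M`. -/
def tszeMk {R M : Type*} (r : R) (m : M) : TrivSqZeroExt R M := (r, m)

/-- If `a • M = M`, then the right multiples of `(a, m)` are exactly the elements whose
first component is a right multiple of `a`. -/
theorem exists_eq_tszeMk_mul_iff
    {A M : Type*} [Ring A] [AddCommGroup M] [Module A M] [Module Aᵐᵒᵖ M]
    {a : A} (ha : ∀ m : M, ∃ m' : M, a • m' = m) (m : M) (y : TrivSqZeroExt A M) :
    (∃ t : TrivSqZeroExt A M, y = tszeMk a m * t) ↔ ∃ b : A, y.fst = a * b := by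
  constructor
  · rintro ⟨t, rfl⟩
    exact ⟨t.fst, rfl⟩
  · rintro ⟨b, hb⟩
    obtain ⟨n, hn⟩ := ha (y.snd - MulOpposite.op b • m)
    refine ⟨tszeMk b n, TrivSqZeroExt.ext hb ?_⟩
    change y.snd = a • n + MulOpposite.op b • m
    rw [hn, sub_add_cancel]

/-- **Ore extensions over duo rings** (Matczuk), Proposition 2.2(1).
Let `A` be a right duo ring, `M` an `(A,A)`-bimodule and `R = TrivSqZeroExt A M`.
If `a ∈ A` satisfies `a • M = M`, then for every `m ∈ M` the principal right ideal
generated by `(a, m)` equals `{(a * b, m') | b ∈ A, m' ∈ M}` and is a two-sided ideal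
of `R`. -/
theorem principal_right_ideal_eq_and_twoSided_of_smul_surjective
    {A M : Type*} [Ring A] [AddCommGroup M] [Module A M] [Module Aᵐᵒᵖ M]
    [SMulCommClass A Aᵐᵒᵖ M]
    (hA : ∀ f r : A, ∃ s : A, r * f = f * s)
    (a : A) (ha : ∀ m : M, ∃ m' : M, a • m' = m) (m : M) :
    (∀ y : TrivSqZeroExt A M,
      (∃ t : TrivSqZeroExt A M, y = tszeMk a m * t) ↔
        ∃ (b : A) (m' : M), y = tszeMk (a * b) m') ∧
    (∀ r y : TrivSqZeroExt A M,
      (∃ t : TrivSqZeroExt A M, y = tszeMk a m * t) →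
        ∃ t : TrivSqZeroExt A M, r * y = tszeMk a m * t) := by
  simp only [exists_eq_tszeMk_mul_iff ha]
  refine ⟨fun y => ⟨?_, ?_⟩, ?_⟩
  · rintro ⟨b, hb⟩
    exact ⟨b, y.snd, TrivSqZeroExt.ext hb rfl⟩
  · rintro ⟨b, m', rfl⟩
    exact ⟨b, rfl⟩
  · rintro r y ⟨b, hb⟩
    obtain ⟨s, hs⟩ := hA a r.fst
    exact ⟨s * b, by rw [TrivSqZeroExt.fst_mul, hb, ← mul_assoc, hs, mul_assoc]⟩
end

section
/- Let A be a right duo ring, M an (A,A)-bimodule, and R = TrivSqZeroExt A M. Assume (i) every right A-submodule N of M is stable under the left A-action (a • n ∈ N for all a ∈ A, n ∈ N), and (ii) a • M = M for every nonzero a ∈ A. Then R is right duo: for all f, r ∈ R there exists s ∈ R with r*f = f*s. -/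
/-- **Ore extensions over duo rings** (Matczuk), Proposition 2.2(2).
Let `A` be a right duo ring and `M` an `(A,A)`-bimodule such that every right
`A`-submodule of `M` is stable under the left `A`-action and `a • M = M` for every
nonzero `a ∈ A`.  Then `R = TrivSqZeroExt A M` is a right duo ring. -/
theorem trivSqZeroExt_rightDuo_of_submodules_leftStable
    {A M : Type*} [Ring A] [AddCommGroup M] [Module A M] [Module Aᵐᵒᵖ M]
    [SMulCommClass A Aᵐᵒᵖ M]
    (hA : ∀ f r : A, ∃ s : A, r * f = f * s)
    (h1 : ∀ (N : Submodule Aᵐᵒᵖ M) (a : A), ∀ n ∈ N, a • n ∈ N)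
    (h2 : ∀ a : A, a ≠ 0 → ∀ m : M, ∃ m' : M, a • m' = m) :
    ∀ f r : TrivSqZeroExt A M, ∃ s : TrivSqZeroExt A M, r * f = f * s := by
  intro f r
  by_cases hf : f.fst = 0
  · obtain ⟨c, hc⟩ := Submodule.mem_span_singleton.mp
      (h1 (Submodule.span Aᵐᵒᵖ {f.snd}) r.fst f.snd (Submodule.mem_span_singleton_self _))
    refine ⟨TrivSqZeroExt.inl c.unop, ?_⟩
    ext <;> simp [hf, hc]
  · obtain ⟨c, hc⟩ := hA f.fst r.fst
    obtain ⟨x, hx⟩ := h2 f.fst hf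
      (r.fst • f.snd + MulOpposite.op f.fst • r.snd - MulOpposite.op c • f.snd)
    refine ⟨TrivSqZeroExt.inl c + TrivSqZeroExt.inr x, ?_⟩
    ext <;> simp [hc, hx]
end

section
/- Let A be a right duo ring and M an (A,A)-bimodule that is faithful as a left A-module (if a • m = 0 for all m ∈ M then a = 0) and simple as a right A-module (M ≠ 0 and its only right A-submodules are 0 and M). Then R = TrivSqZeroExt A M is a right duo ring: for all f, r ∈ R there exists s ∈ R with r*f = f*s. -/
/-- **Ore extensions over duo rings** (Matczuk), Theorem 2.4(1).
Let `A` be a right duo ring and `M` an `(A,A)`-bimodule which is faithful as a left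
`A`-module and simple as a right `A`-module.  Then `R = TrivSqZeroExt A M` is a right
duo ring. -/
theorem trivSqZeroExt_rightDuo_of_leftFaithful_rightSimple
    {A M : Type*} [Ring A] [AddCommGroup M] [Module A M] [Module Aᵐᵒᵖ M]
    [SMulCommClass A Aᵐᵒᵖ M]
    (hA : ∀ f r : A, ∃ s : A, r * f = f * s)
    (hfaith : ∀ a : A, (∀ m : M, a • m = 0) → a = 0)
    (hne : ∃ m : M, m ≠ 0)
    (hsimple : ∀ N : Submodule Aᵐᵒᵖ M, N = ⊥ ∨ N = ⊤) :
    ∀ f r : TrivSqZeroExt A M, ∃ s : TrivSqZeroExt A M, r * f = f * s := by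
  rintro ⟨a, m⟩ ⟨b, n⟩
  by_cases ha : a = 0
  · subst ha
    obtain ⟨c, hc⟩ : ∃ c : A, MulOpposite.op c • m = b • m := by
      rcases hsimple (Submodule.span Aᵐᵒᵖ {m}) with h | h
      · rw [Submodule.span_singleton_eq_bot] at h
        exact ⟨0, by simp [h]⟩
      · have hb : b • m ∈ Submodule.span Aᵐᵒᵖ {m} := h ▸ Submodule.mem_top
        obtain ⟨c, hc⟩ := Submodule.mem_span_singleton.mp hb
        exact ⟨c.unop, hc⟩
    refine ⟨TrivSqZeroExt.inl c, TrivSqZeroExt.ext ?_ ?_⟩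
    · change b * 0 = 0 * c
      simp
    · change b • m + MulOpposite.op (0 : A) • n = (0 : A) • (0 : M) + MulOpposite.op c • m
      simp [hc]
  · obtain ⟨c, hc⟩ := hA a b
    have hsurj : Function.Surjective fun x : M ↦ a • x := by
      rcases hsimple (LinearMap.range (DistribSMul.toLinearMap Aᵐᵒᵖ M a)) with h | h
      · refine absurd (hfaith a fun x ↦ ?_) ha
        exact LinearMap.congr_fun (LinearMap.range_eq_bot.mp h) x
      · exact LinearMap.range_eq_top.mp h
    obtain ⟨k, hk⟩ := hsurj (b • m + MulOpposite.op a • n - MulOpposite.op c • m)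
    exact ⟨(c, k), TrivSqZeroExt.ext hc (sub_eq_iff_eq_add.mp hk.symm)⟩
end

section
/- Let A be a right duo ring and M an (A,A)-bimodule that is faithful as a left A-module (if a • m = 0 for all m ∈ M then a = 0) and simple as a right A-module (M ≠ 0 and its only right A-submodules are 0 and M), and let R = TrivSqZeroExt A M. Then R is left duo (for all f, r ∈ R there exists s ∈ R with f*r = s*f) if and only if M is faithful as a right A-module (if m • a = 0 for all m ∈ M then a = 0) and simple as a left A-module (M ≠ 0 and its only left A-submodules are 0 and M). -/
/-- A nonzero vector of a module without proper nonzero submodules generates it. -/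
theorem exists_smul_eq_of_forall_eq_bot_or_eq_top {S M : Type*} [Ring S] [AddCommGroup M]
    [Module S M] (h : ∀ N : Submodule S M, N = ⊥ ∨ N = ⊤) {m : M} (hm : m ≠ 0) (x : M) :
    ∃ a : S, a • m = x := by
  rcases h (Submodule.span S {m}) with h0 | h1
  · exact absurd (Submodule.span_singleton_eq_bot.1 h0) hm
  · exact Submodule.mem_span_singleton.1 (h1 ▸ Submodule.mem_top)

/-- A right duo ring with a faithful simple right module is a division ring. -/
theorem exists_inverse_of_rightDuo_of_faithful_simple {A M : Type*} [Ring A] [AddCommGroup M]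
    [Module Aᵐᵒᵖ M] (hA : ∀ f r : A, ∃ s : A, r * f = f * s)
    (hfaith : ∀ a : A, (∀ m : M, MulOpposite.op a • m = 0) → a = 0)
    (hne : ∃ m : M, m ≠ 0) (hsimple : ∀ N : Submodule Aᵐᵒᵖ M, N = ⊥ ∨ N = ⊤)
    {a : A} (ha : a ≠ 0) : ∃ b : A, a * b = 1 ∧ b * a = 1 := by
  obtain ⟨m, hm⟩ := hne
  have torsion_free (c : A) (hc : MulOpposite.op c • m = 0) : c = 0 := by
    refine hfaith c fun x => ?_
    obtain ⟨d, rfl⟩ := exists_smul_eq_of_forall_eq_bot_or_eq_top hsimple hm x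
    obtain ⟨s, hs⟩ := hA c d.unop
    rw [← MulOpposite.op_unop d, smul_smul, ← MulOpposite.op_mul, hs, MulOpposite.op_mul,
      mul_smul, hc, smul_zero]
  have right_inverse (c : A) (hc : c ≠ 0) : ∃ b : A, c * b = 1 := by
    obtain ⟨b, hb⟩ := exists_smul_eq_of_forall_eq_bot_or_eq_top hsimple
      (fun h => hc (torsion_free c h)) m
    refine ⟨b.unop, sub_eq_zero.1 (torsion_free _ ?_)⟩
    rw [MulOpposite.op_sub, MulOpposite.op_mul, MulOpposite.op_unop, MulOpposite.op_one,
      sub_smul, mul_smul, hb, one_smul, sub_self]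
  obtain ⟨b, hab⟩ := right_inverse a ha
  have hb : b ≠ 0 := by
    rintro rfl
    apply ha
    rw [← mul_one a, ← hab, mul_zero, mul_zero]
  obtain ⟨c, hbc⟩ := right_inverse b hb
  exact ⟨b, hab, by rwa [left_inv_eq_right_inv hab hbc]⟩

/-- **Ore extensions over duo rings** (Matczuk), Theorem 2.4(2).
Let `A` be a right duo ring and `M` an `(A,A)`-bimodule which is faithful as a left
`A`-module and simple as a right `A`-module, and let `R = TrivSqZeroExt A M`.
Then `R` is left duo if and only if `M` is faithful as a right `A`-module and simple
as a left `A`-module. -/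
theorem trivSqZeroExt_leftDuo_iff_rightFaithful_leftSimple
    {A M : Type*} [Ring A] [AddCommGroup M] [Module A M] [Module Aᵐᵒᵖ M]
    [SMulCommClass A Aᵐᵒᵖ M]
    (hA : ∀ f r : A, ∃ s : A, r * f = f * s)
    (hfaith : ∀ a : A, (∀ m : M, a • m = 0) → a = 0)
    (hne : ∃ m : M, m ≠ 0)
    (hsimple : ∀ N : Submodule Aᵐᵒᵖ M, N = ⊥ ∨ N = ⊤) :
    (∀ f r : TrivSqZeroExt A M, ∃ s : TrivSqZeroExt A M, f * r = s * f) ↔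
      ((∀ a : A, (∀ m : M, MulOpposite.op a • m = 0) → a = 0) ∧
        (∃ m : M, m ≠ 0) ∧
        (∀ N : Submodule A M, N = ⊥ ∨ N = ⊤)) := by
  constructor
  · intro hR
    refine ⟨fun a ha => hfaith a fun m => ?_, hne, fun N => ?_⟩
    · obtain ⟨s, hs⟩ := hR (TrivSqZeroExt.inl a) (TrivSqZeroExt.inr m)
      simpa [ha] using congrArg TrivSqZeroExt.snd hs
    · refine or_iff_not_imp_left.2 fun hN => ?_
      obtain ⟨m, hmN, hm⟩ := (Submodule.ne_bot_iff N).1 hN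
      refine (Submodule.eq_top_iff').2 fun x => ?_
      obtain ⟨a, rfl⟩ := exists_smul_eq_of_forall_eq_bot_or_eq_top hsimple hm x
      obtain ⟨s, hs⟩ := hR (TrivSqZeroExt.inr m) (TrivSqZeroExt.inl a.unop)
      have h : a • m = s.fst • m := by simpa using congrArg TrivSqZeroExt.snd hs
      exact h ▸ N.smul_mem s.fst hmN
  · rintro ⟨hfaith', -, hsimple'⟩ f r
    by_cases hf : f.fst = 0
    · by_cases hm : f.snd = 0
      · exact ⟨0, by ext <;> simp [hf, hm]⟩
      · obtain ⟨s, hs⟩ := exists_smul_eq_of_forall_eq_bot_or_eq_top hsimple' hm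
          (MulOpposite.op r.fst • f.snd)
        exact ⟨TrivSqZeroExt.inl s, by ext <;> simp [hf, hs]⟩
    · obtain ⟨b, -, hb⟩ :=
        exists_inverse_of_rightDuo_of_faithful_simple hA hfaith' hne hsimple hf
      refine ⟨(f.fst * r.fst * b, MulOpposite.op b •
        ((f * r).snd - (f.fst * r.fst * b) • f.snd)), TrivSqZeroExt.ext ?_ ?_⟩
      · change f.fst * r.fst = f.fst * r.fst * b * f.fst
        rw [mul_assoc _ b, hb, mul_one]
      · change (f * r).snd = (f.fst * r.fst * b) • f.snd + MulOpposite.op f.fst •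
          MulOpposite.op b • ((f * r).snd - (f.fst * r.fst * b) • f.snd)
        rw [smul_smul, ← MulOpposite.op_mul, hb, MulOpposite.op_one, one_smul,
          add_sub_cancel]
end

section
/- Let A be a ring, M an (A,A)-bimodule, and suppose R = TrivSqZeroExt A M is right duo. Then every right A-submodule W of M is stable under the left A-action (a • w ∈ W for all a ∈ A, w ∈ W). Consequently, if N is a proper subbimodule of M that is maximal among proper subbimodules (every left-stable right A-submodule strictly containing N equals M), then N is maximal among proper right A-submodules of M: every right A-submodule W with N ⊊ W equals M. -/
/-- **Ore extensions over duo rings** (Matczuk), part of Proposition 2.5.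
If `R = TrivSqZeroExt A M` is right duo, then every right `A`-submodule of `M` is
stable under the left `A`-action; consequently a proper subbimodule of `M` which is
maximal among proper subbimodules is in fact maximal among proper right
`A`-submodules of `M`. -/
theorem submodules_leftStable_of_rightDuo_trivSqZeroExt
    {A M : Type*} [Ring A] [AddCommGroup M] [Module A M] [Module Aᵐᵒᵖ M]
    [SMulCommClass A Aᵐᵒᵖ M]
    (hR : ∀ f r : TrivSqZeroExt A M, ∃ s : TrivSqZeroExt A M, r * f = f * s) :
    (∀ (W : Submodule Aᵐᵒᵖ M) (a : A), ∀ w ∈ W, a • w ∈ W) ∧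
    (∀ N : Submodule Aᵐᵒᵖ M, (∀ (a : A), ∀ n ∈ N, a • n ∈ N) → N ≠ ⊤ →
      (∀ W : Submodule Aᵐᵒᵖ M, (∀ (a : A), ∀ w ∈ W, a • w ∈ W) → N < W → W = ⊤) →
      ∀ W : Submodule Aᵐᵒᵖ M, N < W → W = ⊤) := by
  have stable : ∀ (W : Submodule Aᵐᵒᵖ M) (a : A), ∀ w ∈ W, a • w ∈ W := by
    intro W a w hw
    obtain ⟨s, hs⟩ := hR (TrivSqZeroExt.inr w) (TrivSqZeroExt.inl a)
    have h : a • w = MulOpposite.op s.fst • w := by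
      simpa using congrArg TrivSqZeroExt.snd hs
    exact h ▸ W.smul_mem _ hw
  exact ⟨stable, fun _ _ _ hmax W hNW => hmax W (stable W) hNW⟩
end

section
/- Let A be a right duo ring (for all f, r ∈ A there exists s ∈ A with r*f = f*s) and M an (A,A)-bimodule that is faithful as a left A-module (if a • m = 0 for all m ∈ M then a = 0) and simple as a right A-module (M ≠ 0 and its only right A-submodules are 0 and M). Let P = {a ∈ A | m • a = 0 for all m ∈ M} be the annihilator of the right A-module M. Then P is a two-sided ideal of A, the quotient ring A⧸P is a division ring, and there exists an injective ring homomorphism φ : A →+* A⧸P. -/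
open MulOpposite

/-- The ring congruence identifying the elements which act equally on a right module. -/
def rightActionRingCon (A M : Type*) [Ring A] [AddCommGroup M] [Module Aᵐᵒᵖ M] : RingCon A where
  r a b := ∀ m : M, op a • m = op b • m
  iseqv := ⟨fun _ _ => rfl, fun h m => (h m).symm, fun h k m => (h m).trans (k m)⟩
  add' h k m := by rw [op_add, op_add, add_smul, add_smul, h, k]
  mul' h k m := by rw [op_mul, op_mul, mul_smul, mul_smul, h, k]

theorem rightActionRingCon_apply {A M : Type*} [Ring A] [AddCommGroup M] [Module Aᵐᵒᵖ M]
    {a b : A} : rightActionRingCon A M a b ↔ ∀ m : M, op a • m = op b • m :=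
  Iff.rfl

/-- A nonzero element of a simple right module is a generator. -/
theorem exists_op_smul_eq_of_simple {A M : Type*} [Ring A] [AddCommGroup M] [Module Aᵐᵒᵖ M]
    (hsimple : ∀ N : Submodule Aᵐᵒᵖ M, N = ⊥ ∨ N = ⊤) {m : M} (hm : m ≠ 0) (n : M) :
    ∃ a : A, op a • m = n := by
  have htop : Submodule.span Aᵐᵒᵖ {m} = ⊤ :=
    (hsimple _).resolve_left (by simpa using hm)
  obtain ⟨a, ha⟩ := Submodule.mem_span_singleton.mp (htop ▸ Submodule.mem_top : n ∈ _)
  exact ⟨a.unop, by simpa using ha⟩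

/-- Over a right duo ring, the annihilator of a generator annihilates the whole module. -/
theorem rightActionRingCon_of_generator {A M : Type*} [Ring A] [AddCommGroup M]
    [Module Aᵐᵒᵖ M] (hA : ∀ f r : A, ∃ s : A, r * f = f * s) {m : M}
    (hm : ∀ n : M, ∃ a : A, op a • m = n) {a b : A} (hab : op a • m = op b • m) :
    rightActionRingCon A M a b := by
  rw [rightActionRingCon_apply]
  intro n
  obtain ⟨r, rfl⟩ := hm n
  obtain ⟨s, hs⟩ := hA (a - b) r
  rw [← sub_eq_zero, ← sub_smul, ← op_sub, ← mul_smul, ← op_mul, hs, op_mul, mul_smul,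
    op_sub, sub_smul, hab, sub_self, smul_zero]

/-- **Ore extensions over duo rings** (Matczuk), Lemma 2.6, `(1) ⟹ (2)`.
Let `A` be a right duo ring and `M` an `(A,A)`-bimodule which is faithful as a left
`A`-module and simple as a right `A`-module.  Let `P` be the annihilator of the right
`A`-module `M`.  Then `P` is a two-sided ideal of `A` (encoded by a ring congruence
`c` with `c a b ↔ a - b ∈ P`), the quotient ring `A⧸P` is a division ring, and there
is an injective ring homomorphism `A →+* A⧸P`. -/
theorem exists_ringCon_div_quotient_and_injective_hom
    {A M : Type*} [Ring A] [AddCommGroup M] [Module A M] [Module Aᵐᵒᵖ M]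
    [SMulCommClass A Aᵐᵒᵖ M]
    (hA : ∀ f r : A, ∃ s : A, r * f = f * s)
    (hfaith : ∀ a : A, (∀ m : M, a • m = 0) → a = 0)
    (hne : ∃ m : M, m ≠ 0)
    (hsimple : ∀ N : Submodule Aᵐᵒᵖ M, N = ⊥ ∨ N = ⊤) :
    ∃ c : RingCon A,
      (∀ a b : A, c a b ↔ ∀ m : M, MulOpposite.op (a - b) • m = 0) ∧
      ((0 : c.Quotient) ≠ 1 ∧
        ∀ x : c.Quotient, x ≠ 0 → ∃ y : c.Quotient, x * y = 1 ∧ y * x = 1) ∧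
      (∃ φ : A →+* c.Quotient, Function.Injective φ) := by
  obtain ⟨m, hm⟩ := hne
  have hgen : ∀ n : M, ∃ a : A, op a • m = n := exists_op_smul_eq_of_simple hsimple hm
  set c := rightActionRingCon A M with hc
  have key {a b : A} (h : op a • m = op b • m) : (a : c.Quotient) = b :=
    c.eq.mpr (rightActionRingCon_of_generator hA hgen h)
  have key' {a b : A} (h : (a : c.Quotient) = b) : op a • m = op b • m := c.eq.mp h m
  have hinv : ∀ x : c.Quotient, x ≠ 0 → ∃ y : c.Quotient, y ≠ 0 ∧ x * y = 1 := by
    intro x hx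
    obtain ⟨a, rfl⟩ := Quotient.exists_rep x
    have ha : op a • m ≠ 0 := fun h => hx (key (b := 0) (by simpa using h))
    obtain ⟨b, hb⟩ := exists_op_smul_eq_of_simple hsimple ha m
    refine ⟨(b : c.Quotient), fun h => hm ?_, key (a := a * b) (b := 1) ?_⟩
    · have h1 : op b • op a • m = op (0 : A) • op a • m := c.eq.mp h _
      rwa [hb, op_zero, zero_smul] at h1
    · rw [op_mul, mul_smul, hb, op_one, one_smul]
  refine ⟨c, fun a b => ?_, ⟨fun h => hm ?_, fun x hx => ?_⟩, ?_⟩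
  · simp only [hc, rightActionRingCon_apply, op_sub, sub_smul, sub_eq_zero]
  · simpa using (key' (a := 0) (b := 1) h).symm
  · obtain ⟨y, hy, hxy⟩ := hinv x hx
    obtain ⟨z, -, hyz⟩ := hinv y hy
    exact ⟨y, hxy, by rwa [left_inv_eq_right_inv hxy hyz]⟩
  · choose g hg using fun a : A => hgen (a • m)
    refine ⟨{ toFun := fun a => (g a : c.Quotient)
              map_one' := key (b := 1) (by rw [hg, one_smul, op_one, one_smul])
              map_mul' := fun a b => key (b := g a * g b) (by
                rw [hg, op_mul, mul_smul, mul_smul, hg, ← hg b, smul_comm])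
              map_zero' := key (b := 0) (by rw [hg, zero_smul, op_zero, zero_smul])
              map_add' := fun a b => key (b := g a + g b) (by
                rw [hg, op_add, add_smul, add_smul, hg, hg]) }, ?_⟩
    rw [injective_iff_map_eq_zero]
    intro a ha
    refine hfaith a fun n => ?_
    have h : op (g a) • m = op (0 : A) • m := key' ha
    rw [hg, op_zero, zero_smul] at h
    obtain ⟨r, rfl⟩ := hgen n
    rw [smul_comm, h, smul_zero]
end

section
/- Let k be a field and A a commutative ring that is a finitely generated k-algebra (Algebra.FiniteType k A). Let P be a maximal ideal of A and suppose there exists an injective k-algebra homomorphism φ : A →ₐ[k] A⧸P. Then A is a field. -/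
/-- **Ore extensions over duo rings** (Matczuk), Corollary 2.7(2).
If a commutative finitely generated algebra `A` over a field `k` admits a maximal
ideal `P` and an injective `k`-algebra homomorphism `A →ₐ[k] A⧸P`, then `A` is a
field. -/
theorem isField_of_injective_algHom_to_quotient
    {k A : Type*} [Field k] [CommRing A] [Algebra k A]
    (hfg : Algebra.FiniteType k A) (P : Ideal A) [P.IsMaximal]
    (φ : A →ₐ[k] A ⧸ P) (hφ : Function.Injective φ) :
    IsField A := by
  let : Field (A ⧸ P) := Ideal.Quotient.field P
  have : Algebra.FiniteType k (A ⧸ P) :=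
    hfg.of_surjective (Ideal.Quotient.mkₐ k P) Ideal.Quotient.mk_surjective
  have : Module.Finite k (A ⧸ P) := finite_of_finite_type_of_isJacobsonRing k (A ⧸ P)
  have : Module.Finite k A := Module.Finite.of_injective φ.toLinearMap hφ
  have : IsDomain A := hφ.isDomain φ.toRingHom
  exact isField_of_isIntegral_of_isField' (Field.toIsField k)
end

section
/- Let A be a commutative domain, P a maximal ideal of A, K = A⧸P with quotient map π, φ : A →+* K an injective ring homomorphism, R = TrivSqZeroExt A K with multiplication (a,k)*(a',k') = (a*a', φ(a)*k' + k*π(a')), and σ(a,k) = (a,0). For ω ∈ K define δ_ω(a,k) = (0, ω*k). Then δ_ω is a σ-derivation of R, i.e., δ_ω is additive and δ_ω(r*s) = σ(r)*δ_ω(s) + δ_ω(r)*s for all r, s ∈ R. Moreover, δ_ω is an inner σ-derivation (there exists y ∈ R with δ_ω(r) = y*r − σ(r)*y for all r ∈ R) if and only if ω ∈ Set.range φ. -/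
/-- **Ore extensions over duo rings** (Matczuk), Lemma 3.2.
With `R = TrivSqZeroExt A K` (bimodule actions `a • k = φ a * k`, `k • a = k * π a`)
and `σ (a, k) = (a, 0)`, the map `δ_ω (a, k) = (0, ω * k)` is a `σ`-derivation of `R`,
and it is an inner `σ`-derivation iff `ω ∈ Set.range φ`. -/
theorem deltaOmega_isSigmaDerivation_and_inner_iff
    {A K : Type*} [CommRing A] [IsDomain A] [Field K]
    (P : Ideal A) [P.IsMaximal] (π : A →+* K) (hπ : Function.Surjective π)
    (hker : RingHom.ker π = P) (φ : A →+* K) (hφ : Function.Injective φ)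
    (ω : K) :
    letI : Module A K := Module.compHom K φ
    letI : Module Aᵐᵒᵖ K := Module.compHom K (π.fromOpposite fun _ _ => mul_comm _ _)
    letI : SMulCommClass A Aᵐᵒᵖ K := ⟨fun _ _ _ => mul_left_comm _ _ _⟩
    (∀ r s : TrivSqZeroExt A K,
        tszeMk (0 : A) (ω * (r + s).snd)
          = tszeMk (0 : A) (ω * r.snd) + tszeMk (0 : A) (ω * s.snd)) ∧
    (∀ r s : TrivSqZeroExt A K,
        tszeMk (0 : A) (ω * (r * s).snd)
          = tszeMk r.fst (0 : K) * tszeMk (0 : A) (ω * s.snd)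
            + tszeMk (0 : A) (ω * r.snd) * s) ∧
    ((∃ y : TrivSqZeroExt A K, ∀ r : TrivSqZeroExt A K,
        tszeMk (0 : A) (ω * r.snd) = y * r - tszeMk r.fst (0 : K) * y) ↔
      ω ∈ Set.range φ) := by
  let : Module A K := Module.compHom K φ
  let : Module Aᵐᵒᵖ K := Module.compHom K (π.fromOpposite fun _ _ => mul_comm _ _)
  let : SMulCommClass A Aᵐᵒᵖ K := ⟨fun _ _ _ => mul_left_comm _ _ _⟩
  have left_smul (a : A) (k : K) : a • k = φ a * k := rfl
  have right_smul (a : A) (k : K) : MulOpposite.op a • k = π a * k := rfl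
  have fst_mk (a : A) (k : K) : (tszeMk a k).fst = a := rfl
  have snd_mk (a : A) (k : K) : (tszeMk a k).snd = k := rfl
  refine ⟨fun r s => ?_, fun r s => ?_, ?_, ?_⟩
  · ext
    · simp [fst_mk]
    · simp [snd_mk, mul_add]
  · ext
    · simp [fst_mk]
    · simp only [TrivSqZeroExt.snd_add, TrivSqZeroExt.snd_mul, fst_mk, snd_mk,
        left_smul, right_smul, map_zero]
      ring
  · rintro ⟨y, hy⟩
    refine ⟨y.fst, ?_⟩
    have h := congrArg TrivSqZeroExt.snd (hy (tszeMk 0 1))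
    simp only [TrivSqZeroExt.snd_sub, TrivSqZeroExt.snd_mul, fst_mk, snd_mk,
      left_smul, right_smul, map_zero] at h
    linear_combination -h
  · rintro ⟨b, rfl⟩
    refine ⟨tszeMk b 0, fun r => ?_⟩
    ext
    · simp only [TrivSqZeroExt.fst_sub, TrivSqZeroExt.fst_mul, fst_mk]
      ring
    · simp only [TrivSqZeroExt.snd_sub, TrivSqZeroExt.snd_mul, fst_mk, snd_mk,
        left_smul, right_smul]
      ring
end

section
/- Let A be a commutative domain, P a maximal ideal of A, K = A⧸P with quotient map π, φ : A →+* K an injective ring homomorphism, R = TrivSqZeroExt A K with multiplication (a,k)*(a',k') = (a*a', φ(a)*k' + k*π(a')), and σ(a,k) = (a,0). Assume R is noncommutative, i.e., there exists a ∈ A with φ(a) ≠ π(a). If δ : R → R is a σ-derivation satisfying δ(0,k) = 0 for all k ∈ K, then δ is inner: there exists y ∈ R with δ(r) = y*r − σ(r)*y for all r ∈ R. -/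
/-- **Ore extensions over duo rings** (Matczuk), Theorem 3.3(2) (noncommutative case).
With `R = TrivSqZeroExt A K` noncommutative (i.e. `φ a ≠ π a` for some `a`) and
`σ (a, k) = (a, 0)`, every `σ`-derivation `δ` of `R` vanishing on `{(0, k) | k ∈ K}`
is inner. -/
theorem sigma_derivation_inner_of_vanishes_on_vK
    {A K : Type*} [CommRing A] [IsDomain A] [Field K]
    (P : Ideal A) [P.IsMaximal] (π : A →+* K) (hπ : Function.Surjective π)
    (hker : RingHom.ker π = P) (φ : A →+* K) (hφ : Function.Injective φ)
    (hnc : ∃ a : A, φ a ≠ π a) :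
    letI : Module A K := Module.compHom K φ
    letI : Module Aᵐᵒᵖ K := Module.compHom K (π.fromOpposite fun _ _ => mul_comm _ _)
    letI : SMulCommClass A Aᵐᵒᵖ K := ⟨fun _ _ _ => mul_left_comm _ _ _⟩
    ∀ δ : TrivSqZeroExt A K → TrivSqZeroExt A K,
      (∀ r s : TrivSqZeroExt A K, δ (r + s) = δ r + δ s) →
      (∀ r s : TrivSqZeroExt A K, δ (r * s) = tszeMk r.fst (0 : K) * δ s + δ r * s) →
      (∀ k : K, δ (tszeMk (0 : A) k) = 0) →
      ∃ y : TrivSqZeroExt A K, ∀ r : TrivSqZeroExt A K,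
        δ r = y * r - tszeMk r.fst (0 : K) * y := by
  let : Module A K := Module.compHom K φ
  let : Module Aᵐᵒᵖ K := Module.compHom K (π.fromOpposite fun _ _ => mul_comm _ _)
  let : SMulCommClass A Aᵐᵒᵖ K := ⟨fun _ _ _ => mul_left_comm _ _ _⟩
  intro δ hadd hmul hv
  obtain ⟨a₀, ha₀⟩ := hnc
  have hlsmul : ∀ (a : A) (k : K), a • k = φ a * k := fun _ _ => rfl
  have hrsmul : ∀ (a : A) (k : K), MulOpposite.op a • k = π a * k := fun _ _ => rfl
  have hmk_fst : ∀ (a : A) (k : K), (tszeMk a k).fst = a := fun _ _ => rfl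
  have hmk_snd : ∀ (a : A) (k : K), (tszeMk a k).snd = k := fun _ _ => rfl
  have hδ_fst_eq : ∀ r, δ r = δ (tszeMk r.fst 0) := fun r => by
    have hr : r = tszeMk r.fst 0 + tszeMk 0 r.snd := by
      ext <;> simp [hmk_fst, hmk_snd]
    conv_lhs => rw [hr, hadd, hv, add_zero]
  have hfst : ∀ r, (δ r).fst = 0 := fun r => by
    have hprod : r * tszeMk 0 1 = tszeMk 0 (φ r.fst) := by
      ext <;> simp [hmk_fst, hmk_snd, hlsmul]
    have h := congrArg TrivSqZeroExt.snd (hmul r (tszeMk 0 1))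
    rw [hprod, hv, hv] at h
    simp only [mul_zero, zero_add, TrivSqZeroExt.snd_mul, TrivSqZeroExt.snd_zero, hmk_fst,
      hmk_snd, hlsmul, hrsmul, map_zero, zero_mul, add_zero, mul_one] at h
    exact hφ (by rw [← h, map_zero])
  have hsnd : ∀ a b : A, (δ (tszeMk (a * b) 0)).snd =
      φ a * (δ (tszeMk b 0)).snd + π b * (δ (tszeMk a 0)).snd := fun a b => by
    have hprod : tszeMk (a * b) (0 : K) = tszeMk a 0 * tszeMk b 0 := by
      ext <;> simp [hmk_fst, hmk_snd]
    rw [hprod, hmul]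
    simp [hmk_fst, hmk_snd, hlsmul, hrsmul]
  have hne : φ a₀ - π a₀ ≠ 0 := sub_ne_zero.mpr ha₀
  refine ⟨tszeMk 0 (-((δ (tszeMk a₀ 0)).snd / (φ a₀ - π a₀))), fun r => ?_⟩
  ext
  · simp [hfst, hmk_fst]
  · have hcomm := hsnd a₀ r.fst
    rw [mul_comm, hsnd] at hcomm
    rw [hδ_fst_eq r]
    simp only [TrivSqZeroExt.snd_sub, TrivSqZeroExt.snd_mul, hmk_fst, hmk_snd, hlsmul, hrsmul,
      map_zero, zero_mul, zero_add, mul_zero, add_zero]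
    field_simp
    linear_combination -hcomm
end

section
/- Let A be a commutative domain, P a maximal ideal of A, K = A⧸P with quotient map π, φ : A →+* K an injective ring homomorphism, R = TrivSqZeroExt A K with multiplication (a,k)*(a',k') = (a*a', φ(a)*k' + k*π(a')), and σ(a,k) = (a,0). Let δ : R → R be a σ-derivation and ω ∈ K with δ(0,1) = (0,ω). Then δ(0,k) = (0, ω*k) for all k ∈ K; that is, the σ-derivation δ − δ_ω vanishes on {(0,k) | k ∈ K}, where δ_ω(a,k) = (0, ω*k). -/
/-- **Ore extensions over duo rings** (Matczuk), Theorem 3.3(3).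
With `R = TrivSqZeroExt A K` and `σ (a, k) = (a, 0)`, if `δ` is a `σ`-derivation of
`R` and `δ (0, 1) = (0, ω)`, then `δ (0, k) = (0, ω * k)` for all `k ∈ K`; that is,
`δ - δ_ω` vanishes on `{(0, k) | k ∈ K}`. -/
theorem sigma_derivation_sub_deltaOmega_vanishes_on_vK
    {A K : Type*} [CommRing A] [IsDomain A] [Field K]
    (P : Ideal A) [P.IsMaximal] (π : A →+* K) (hπ : Function.Surjective π)
    (hker : RingHom.ker π = P) (φ : A →+* K) (hφ : Function.Injective φ) :
    letI : Module A K := Module.compHom K φ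
    letI : Module Aᵐᵒᵖ K := Module.compHom K (π.fromOpposite fun _ _ => mul_comm _ _)
    letI : SMulCommClass A Aᵐᵒᵖ K := ⟨fun _ _ _ => mul_left_comm _ _ _⟩
    ∀ δ : TrivSqZeroExt A K → TrivSqZeroExt A K,
      (∀ r s : TrivSqZeroExt A K, δ (r + s) = δ r + δ s) →
      (∀ r s : TrivSqZeroExt A K, δ (r * s) = tszeMk r.fst (0 : K) * δ s + δ r * s) →
      ∀ ω : K, δ (tszeMk (0 : A) (1 : K)) = tszeMk (0 : A) ω →
        ∀ k : K, δ (tszeMk (0 : A) k) = tszeMk (0 : A) (ω * k) := by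
  letI : Module A K := Module.compHom K φ
  letI : Module Aᵐᵒᵖ K := Module.compHom K (π.fromOpposite fun _ _ => mul_comm _ _)
  letI : SMulCommClass A Aᵐᵒᵖ K := ⟨fun _ _ _ => mul_left_comm _ _ _⟩
  intro δ _ hmul ω hω k
  obtain ⟨a, rfl⟩ := hπ k
  -- right multiplication by `(a, 0)` acts on `(0, x)` through `π`
  have hright (x : K) :
      tszeMk (0 : A) x * tszeMk a (0 : K) = tszeMk (0 : A) (x * π a) := by
    refine TrivSqZeroExt.ext (zero_mul a) ?_
    change φ 0 * 0 + π a * x = x * π a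
    ring
  have hzero : tszeMk (tszeMk (0 : A) (1 : K)).fst (0 : K) = 0 := rfl
  rw [← one_mul (π a), ← hright, hmul, hω, hright, hzero, zero_mul, zero_add, one_mul]
end

section
/- Let A be a commutative domain, P a maximal ideal of A, K = A⧸P with quotient map π, φ : A →+* K an injective ring homomorphism, R = TrivSqZeroExt A K with multiplication (a,k)*(a',k') = (a*a', φ(a)*k' + k*π(a')), and σ(a,k) = (a,0). Assume R is noncommutative, i.e., there exists a ∈ A with φ(a) ≠ π(a). For a σ-derivation δ of R, the following are equivalent: (1) δ is not inner (there is no y ∈ R with δ(r) = y*r − σ(r)*y for all r); (2) there exist ω ∈ K with ω ∉ Set.range φ and y ∈ R such that δ(a,k) = (0, ω*k) + y*(a,k) − σ(a,k)*y for all (a,k) ∈ R. -/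
/-- **Ore extensions over duo rings** (Matczuk), Corollary 3.4.
With `R = TrivSqZeroExt A K` noncommutative (i.e. `φ a ≠ π a` for some `a`) and
`σ (a, k) = (a, 0)`, a `σ`-derivation `δ` of `R` is outer (not inner) iff
`δ = δ_ω + d_y` for some `ω ∉ Set.range φ` and some `y ∈ R`. -/
theorem sigma_derivation_outer_iff
    {A K : Type*} [CommRing A] [IsDomain A] [Field K]
    (P : Ideal A) [P.IsMaximal] (π : A →+* K) (hπ : Function.Surjective π)
    (hker : RingHom.ker π = P) (φ : A →+* K) (hφ : Function.Injective φ)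
    (hnc : ∃ a : A, φ a ≠ π a) :
    letI : Module A K := Module.compHom K φ
    letI : Module Aᵐᵒᵖ K := Module.compHom K (π.fromOpposite fun _ _ => mul_comm _ _)
    letI : SMulCommClass A Aᵐᵒᵖ K := ⟨fun _ _ _ => mul_left_comm _ _ _⟩
    ∀ δ : TrivSqZeroExt A K → TrivSqZeroExt A K,
      (∀ r s : TrivSqZeroExt A K, δ (r + s) = δ r + δ s) →
      (∀ r s : TrivSqZeroExt A K, δ (r * s) = tszeMk r.fst (0 : K) * δ s + δ r * s) →
      ((¬ ∃ y : TrivSqZeroExt A K, ∀ r : TrivSqZeroExt A K,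
          δ r = y * r - tszeMk r.fst (0 : K) * y) ↔
        ∃ ω : K, ω ∉ Set.range φ ∧ ∃ y : TrivSqZeroExt A K, ∀ (a : A) (k : K),
          δ (tszeMk a k) = tszeMk (0 : A) (ω * k) + y * tszeMk a k - tszeMk a (0 : K) * y) := by
  let : Module A K := Module.compHom K φ
  let : Module Aᵐᵒᵖ K := Module.compHom K (π.fromOpposite fun _ _ => mul_comm _ _)
  let : SMulCommClass A Aᵐᵒᵖ K := ⟨fun _ _ _ => mul_left_comm _ _ _⟩
  intro δ hadd hmul
  have mk_fst (a : A) (k : K) : (tszeMk a k).fst = a := rfl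
  have mk_snd (a : A) (k : K) : (tszeMk a k).snd = k := rfl
  have fst_mul (x y : TrivSqZeroExt A K) : (x * y).fst = x.fst * y.fst := rfl
  have snd_mul (x y : TrivSqZeroExt A K) :
      (x * y).snd = φ x.fst * y.snd + π y.fst * x.snd := rfl
  have mk_mul (a b : A) (k l : K) :
      tszeMk a k * tszeMk b l = tszeMk (a * b) (φ a * l + π b * k) := rfl
  have hfst (a b : A) (k l : K) : (δ (tszeMk (a * b) (φ a * l + π b * k))).fst
      = a * (δ (tszeMk b l)).fst + (δ (tszeMk a k)).fst * b := by
    rw [← mk_mul, hmul]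
    rfl
  have hsnd (a b : A) (k l : K) : (δ (tszeMk (a * b) (φ a * l + π b * k))).snd
      = φ a * (δ (tszeMk b l)).snd
        + (φ (δ (tszeMk a k)).fst * l + π b * (δ (tszeMk a k)).snd) := by
    rw [← mk_mul, hmul, TrivSqZeroExt.snd_add, snd_mul, snd_mul]
    simp only [mk_fst, mk_snd, mul_zero, add_zero]
  have hsplit (a : A) (k : K) :
      δ (tszeMk a k) = δ (tszeMk a 0) + δ (tszeMk 0 k) := by
    rw [← hadd]
    congr 1
    exact Prod.ext (add_zero a).symm (zero_add k).symm
  obtain ⟨a₀, ha₀⟩ := hnc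
  have hfst_zero (k : K) : (δ (tszeMk 0 k)).fst = 0 := by
    obtain ⟨b, hb⟩ := hπ (φ a₀)
    have h₁ := hfst a₀ 0 0 k
    have h₂ := hfst 0 b k 0
    simp only [mul_zero, zero_mul, add_zero, zero_add, map_zero, hb] at h₁ h₂
    by_contra hne
    have hab : a₀ = b := mul_right_cancel₀ hne (by rw [← h₁, h₂, mul_comm])
    exact ha₀ (by rw [← hb, hab])
  have hω (k : K) : (δ (tszeMk 0 k)).snd = (δ (tszeMk 0 1)).snd * k := by
    obtain ⟨b, rfl⟩ := hπ k
    have h := hsnd 0 b 1 0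
    simp only [mul_zero, zero_mul, mul_one, zero_add, map_zero] at h
    rw [h, mul_comm]
  have hfst_base (a : A) : (δ (tszeMk a 0)).fst = 0 := by
    have h := hsnd a 0 0 1
    simp only [mul_zero, zero_mul, mul_one, add_zero, map_zero] at h
    rw [hω, mul_comm, left_eq_add] at h
    exact hφ (h.trans (map_zero φ).symm)
  obtain ⟨c, hc⟩ : ∃ c : K, ∀ a, (δ (tszeMk a 0)).snd = c * (π a - φ a) := by
    have hne : π a₀ - φ a₀ ≠ 0 := sub_ne_zero.mpr ha₀.symm
    refine ⟨(δ (tszeMk a₀ 0)).snd / (π a₀ - φ a₀), fun a => ?_⟩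
    have h₁ := hsnd a a₀ 0 0
    have h₂ := hsnd a₀ a 0 0
    simp only [mul_zero, add_zero, zero_add] at h₁ h₂
    rw [mul_comm a₀ a, h₁] at h₂
    field_simp
    linear_combination h₂
  have hδ (a : A) (k : K) :
      δ (tszeMk a k) = tszeMk 0 (c * (π a - φ a) + (δ (tszeMk 0 1)).snd * k) := by
    rw [hsplit]
    refine TrivSqZeroExt.ext ?_ ?_
    · rw [TrivSqZeroExt.fst_add, hfst_base, hfst_zero, add_zero, mk_fst]
    · rw [TrivSqZeroExt.snd_add, hc, hω, mk_snd]
  have hinner (b a : A) (l k : K) :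
      tszeMk b l * tszeMk a k - tszeMk a 0 * tszeMk b l
        = tszeMk 0 (φ b * k + l * (π a - φ a)) := by
    refine TrivSqZeroExt.ext ?_ ?_
    · rw [TrivSqZeroExt.fst_sub, fst_mul, fst_mul]
      simp only [mk_fst]
      ring
    · rw [TrivSqZeroExt.snd_sub, snd_mul, snd_mul]
      simp only [mk_fst, mk_snd]
      ring
  have mk_add (k l : K) : tszeMk (0 : A) k + tszeMk 0 l = tszeMk 0 (k + l) :=
    Prod.ext (add_zero 0) rfl
  constructor
  · intro hout
    refine ⟨(δ (tszeMk 0 1)).snd, ?_, tszeMk 0 c, fun a k => ?_⟩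
    · rintro ⟨b, hb⟩
      refine hout ⟨tszeMk b c, fun r => ?_⟩
      refine (hδ r.fst r.snd).trans (Eq.trans ?_ (hinner b r.fst c r.snd).symm)
      rw [hb, add_comm]
    · rw [add_sub_assoc, hinner, hδ a k, mk_add, map_zero, zero_mul, zero_add, add_comm]
  · rintro ⟨ω, hω_range, y, hy⟩ ⟨z, hz⟩
    have h₁ := hy 0 1
    rw [hz, mk_fst, add_sub_assoc] at h₁
    have h₂ := (hinner z.fst 0 z.snd 1).symm.trans
      (h₁.trans (congrArg (tszeMk (0 : A) (ω * 1) + ·) (hinner y.fst 0 y.snd 1)))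
    have h₃ := congrArg TrivSqZeroExt.snd (h₂.trans (mk_add _ _))
    simp only [mk_snd, map_zero, sub_self, mul_zero, add_zero, mul_one] at h₃
    exact hω_range ⟨z.fst - y.fst, by rw [map_sub, h₃, add_sub_cancel_right]⟩
end

section
/- Let A be a commutative domain, P a maximal ideal of A, K = A⧸P with quotient map π : A → K, φ : A →+* K an injective ring homomorphism, and ω ∈ K. Let φ_ω = Polynomial.eval₂ φ ω : A[X] → K and π̄ = Polynomial.map π : A[X] → K[X], and let T_ω = TrivSqZeroExt A[X] K[X] with multiplication (p,q)*(p',q') = (p*p', C(φ_ω(p))*q' + q*π̄(p')). Then for f = (p,q) ∈ T_ω, the principal right ideal {f*t | t ∈ T_ω} is a two-sided ideal of T_ω (closed under left multiplication by arbitrary elements of T_ω) if and only if φ_ω(p) ≠ 0, or p = 0, or (π̄(p) = 0 and q = 0). -/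
/-- **Ore extensions over duo rings** (Matczuk), Proposition 4.4.
`T_ω = TrivSqZeroExt A[X] K[X]` with actions `p • q = C (eval₂ φ ω p) * q` and
`q • p = q * map π p` (ring-isomorphic to the Ore extension `R[x; σ, δ_ω]`).
For `f = (p, q) ∈ T_ω`, the principal right ideal `f * T_ω` is a two-sided ideal iff
`eval₂ φ ω p ≠ 0`, or `p = 0`, or (`map π p = 0` and `q = 0`). -/
theorem principal_right_ideal_twoSided_iff
    {A K : Type*} [CommRing A] [IsDomain A] [Field K]
    (P : Ideal A) [P.IsMaximal] (π : A →+* K) (hπ : Function.Surjective π)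
    (hker : RingHom.ker π = P) (φ : A →+* K) (hφ : Function.Injective φ)
    (ω : K) :
    letI : Module (Polynomial A) (Polynomial K) :=
      Module.compHom (Polynomial K)
        ((Polynomial.C : K →+* Polynomial K).comp (Polynomial.eval₂RingHom φ ω))
    letI : Module (Polynomial A)ᵐᵒᵖ (Polynomial K) :=
      Module.compHom (Polynomial K)
        ((Polynomial.mapRingHom π).fromOpposite fun _ _ => mul_comm _ _)
    letI : SMulCommClass (Polynomial A) (Polynomial A)ᵐᵒᵖ (Polynomial K) :=
      ⟨fun _ _ _ => mul_left_comm _ _ _⟩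
    ∀ (p : Polynomial A) (q : Polynomial K),
      ((∀ g y : TrivSqZeroExt (Polynomial A) (Polynomial K),
          (∃ t, y = tszeMk p q * t) → ∃ t, g * y = tszeMk p q * t) ↔
        (Polynomial.eval₂ φ ω p ≠ 0 ∨ p = 0 ∨ (Polynomial.map π p = 0 ∧ q = 0))) := by
  let : Module (Polynomial A) (Polynomial K) :=
    Module.compHom (Polynomial K)
      ((Polynomial.C : K →+* Polynomial K).comp (Polynomial.eval₂RingHom φ ω))
  let : Module (Polynomial A)ᵐᵒᵖ (Polynomial K) :=
    Module.compHom (Polynomial K)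
      ((Polynomial.mapRingHom π).fromOpposite fun _ _ => mul_comm _ _)
  let : SMulCommClass (Polynomial A) (Polynomial A)ᵐᵒᵖ (Polynomial K) :=
    ⟨fun _ _ _ => mul_left_comm _ _ _⟩
  intro p q
  have hmul (g : TrivSqZeroExt (Polynomial A) (Polynomial K)) (t) :
      g * t = tszeMk (g.fst * t.fst) (Polynomial.C (Polynomial.eval₂ φ ω g.fst) * t.snd
        + Polynomial.map π t.fst * g.snd) := rfl
  have hfst (r : Polynomial A) (m : Polynomial K) : (tszeMk r m).fst = r := rfl
  have hsnd (r : Polynomial A) (m : Polynomial K) : (tszeMk r m).snd = m := rfl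
  have hinj (r r' : Polynomial A) (m m' : Polynomial K) :
      tszeMk r m = tszeMk r' m' ↔ r = r' ∧ m = m' := Prod.mk_inj
  constructor
  · intro h
    by_cases hp : Polynomial.eval₂ φ ω p = 0
    · by_cases hp0 : p = 0
      · exact Or.inr (Or.inl hp0)
      have key (a : Polynomial A) (b : Polynomial K) :
          Polynomial.C (Polynomial.eval₂ φ ω a) * q + Polynomial.map π p * b
            = Polynomial.map π a * q := by
        obtain ⟨t, ht⟩ := h (tszeMk a b) _ ⟨tszeMk 1 0, rfl⟩
        simp only [hmul, hfst, hsnd, hinj, hp, Polynomial.map_one, mul_one,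
          mul_zero, map_zero, zero_mul, zero_add, one_mul] at ht
        obtain ⟨h₁, h₂⟩ := ht
        have hta : t.fst = a := mul_left_cancel₀ hp0 (by rw [← h₁, mul_comm])
        rw [h₂, hta]
      refine Or.inr (Or.inr ⟨by simpa using key 0 1, ?_⟩)
      have hX : (Polynomial.X - Polynomial.C ω) * q = 0 := by
        have := key Polynomial.X 0
        simp only [Polynomial.eval₂_X, Polynomial.map_X, mul_zero, add_zero] at this
        rw [sub_mul, this, sub_self]
      exact (mul_eq_zero.mp hX).resolve_left (Polynomial.X_sub_C_ne_zero ω)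
    · exact Or.inl hp
  · rintro h g _ ⟨t, rfl⟩
    by_cases hp : Polynomial.eval₂ φ ω p = 0
    · rcases h with h | rfl | ⟨h, rfl⟩
      · exact absurd hp h
      · obtain ⟨c, hc⟩ := hπ (Polynomial.eval₂ φ ω g.fst)
        refine ⟨tszeMk (Polynomial.C c * t.fst) 0, ?_⟩
        simp [hmul, hfst, hsnd, hc, mul_assoc]
      · refine ⟨tszeMk (g.fst * t.fst) 0, ?_⟩
        simp [hmul, hfst, hsnd, hp, h, mul_left_comm]
    · refine ⟨tszeMk (g.fst * t.fst) (Polynomial.C (Polynomial.eval₂ φ ω p)⁻¹ *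
        ((g * (tszeMk p q * t)).snd - Polynomial.map π (g.fst * t.fst) * q)), ?_⟩
      have hC : Polynomial.C (Polynomial.eval₂ φ ω p) *
          Polynomial.C (Polynomial.eval₂ φ ω p)⁻¹ = 1 := by
        rw [← Polynomial.C_mul, mul_inv_cancel₀ hp, Polynomial.C_1]
      rw [hmul (tszeMk p q) (tszeMk _ _)]
      simp only [hfst, hsnd, ← mul_assoc, hC, one_mul, sub_add_cancel]
      simp only [hmul, hfst, hsnd, hinj, and_true]
      ring
end

section
/- Let A be a commutative domain, P a maximal ideal of A, K = A⧸P with quotient map π : A → K, φ : A →+* K an injective ring homomorphism, ω ∈ K, and T_ω = TrivSqZeroExt A[X] K[X] with multiplication (p,q)*(p',q') = (p*p', C(φ_ω(p))*q' + q*π̄(p')), where φ_ω = Polynomial.eval₂ φ ω and π̄ = Polynomial.map π. Then T_ω is a right duo ring (for all f, r ∈ T_ω there exists s ∈ T_ω with r*f = f*s) if and only if ω is transcendental over the image of φ, i.e., the only polynomial p ∈ A[X] with φ_ω(p) = 0 is p = 0. -/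
open Polynomial in
/-- The right duo criterion for `TrivSqZeroExt A[X] K[X]`, for any left and right actions given
by `p • q = C (eval₂ φ ω p) * q` and `q • p = map π p * q`. -/
theorem trivSqZeroExt_rightDuo_iff_eval₂_injective {A K : Type*} [CommRing A] [IsDomain A]
    [Field K] {π : A →+* K} (hπ : Function.Surjective π) (φ : A →+* K) (ω : K)
    [Module A[X] K[X]] [Module A[X]ᵐᵒᵖ K[X]]
    (hl : ∀ (p : A[X]) (q : K[X]), p • q = C (eval₂ φ ω p) * q)
    (hr : ∀ (p : A[X]) (q : K[X]), MulOpposite.op p • q = map π p * q) :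
    (∀ f r : TrivSqZeroExt A[X] K[X], ∃ s : TrivSqZeroExt A[X] K[X], r * f = f * s) ↔
      ∀ p : A[X], eval₂ φ ω p = 0 → p = 0 := by
  constructor
  · intro duo p hp
    by_contra hp0
    obtain ⟨s, hs⟩ := duo (TrivSqZeroExt.inl p + TrivSqZeroExt.inr 1)
      (TrivSqZeroExt.inl Polynomial.X)
    have h1 := congrArg TrivSqZeroExt.fst hs
    have h2 := congrArg TrivSqZeroExt.snd hs
    simp only [TrivSqZeroExt.fst_mul, TrivSqZeroExt.fst_add, TrivSqZeroExt.fst_inl,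
      TrivSqZeroExt.fst_inr, add_zero] at h1
    have hsX : s.fst = Polynomial.X :=
      (mul_left_cancel₀ hp0 ((mul_comm p Polynomial.X).trans h1)).symm
    simp only [TrivSqZeroExt.snd_mul, TrivSqZeroExt.fst_add, TrivSqZeroExt.fst_inl,
      TrivSqZeroExt.fst_inr, TrivSqZeroExt.snd_add, TrivSqZeroExt.snd_inl,
      TrivSqZeroExt.snd_inr, hl, hr, hsX, hp, Polynomial.eval₂_X, Polynomial.map_X,
      map_zero, zero_mul, mul_zero, zero_add, add_zero, mul_one] at h2
    exact Polynomial.X_ne_C ω h2.symm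
  · intro trans f r
    by_cases hf : f.fst = 0
    · obtain ⟨c, hc⟩ := hπ (Polynomial.eval₂ φ ω r.fst)
      refine ⟨TrivSqZeroExt.inl (Polynomial.C c), TrivSqZeroExt.ext ?_ ?_⟩
      · simp [hf]
      · simp only [TrivSqZeroExt.snd_mul, TrivSqZeroExt.fst_inl, TrivSqZeroExt.snd_inl, hl, hr,
          hf, Polynomial.map_C, hc, Polynomial.map_zero, zero_mul, mul_zero, add_zero, zero_add]
    · have hu : Polynomial.eval₂ φ ω f.fst ≠ 0 := fun h => hf (trans _ h)
      refine ⟨TrivSqZeroExt.inl r.fst + TrivSqZeroExt.inr (C (eval₂ φ ω f.fst)⁻¹ *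
        (C (eval₂ φ ω r.fst) * f.snd + map π f.fst * r.snd - map π r.fst * f.snd)),
        TrivSqZeroExt.ext ?_ ?_⟩
      · simp [mul_comm]
      · simp only [TrivSqZeroExt.snd_mul, TrivSqZeroExt.fst_add, TrivSqZeroExt.fst_inl,
          TrivSqZeroExt.fst_inr, TrivSqZeroExt.snd_add, TrivSqZeroExt.snd_inl,
          TrivSqZeroExt.snd_inr, add_zero, zero_add, hl, hr]
        rw [← mul_assoc, ← Polynomial.C_mul, mul_inv_cancel₀ hu, Polynomial.C_1, one_mul,
          sub_add_cancel]

/-- **Ore extensions over duo rings** (Matczuk), Corollary 4.5(1) and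
Theorem 4.7(2).  `T_ω = TrivSqZeroExt A[X] K[X]` with actions
`p • q = C (eval₂ φ ω p) * q` and `q • p = q * map π p` (ring-isomorphic to the Ore
extension `R[x; σ, δ_ω]`) is a right duo ring iff `ω` is transcendental over the
image of `φ`, i.e. the only polynomial `p ∈ A[X]` with `eval₂ φ ω p = 0` is `p = 0`. -/
theorem tOmega_rightDuo_iff_transcendental
    {A K : Type*} [CommRing A] [IsDomain A] [Field K]
    (P : Ideal A) [P.IsMaximal] (π : A →+* K) (hπ : Function.Surjective π)
    (hker : RingHom.ker π = P) (φ : A →+* K) (hφ : Function.Injective φ)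
    (ω : K) :
    letI : Module (Polynomial A) (Polynomial K) :=
      Module.compHom (Polynomial K)
        ((Polynomial.C : K →+* Polynomial K).comp (Polynomial.eval₂RingHom φ ω))
    letI : Module (Polynomial A)ᵐᵒᵖ (Polynomial K) :=
      Module.compHom (Polynomial K)
        ((Polynomial.mapRingHom π).fromOpposite fun _ _ => mul_comm _ _)
    letI : SMulCommClass (Polynomial A) (Polynomial A)ᵐᵒᵖ (Polynomial K) :=
      ⟨fun _ _ _ => mul_left_comm _ _ _⟩
    ((∀ f r : TrivSqZeroExt (Polynomial A) (Polynomial K),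
        ∃ s : TrivSqZeroExt (Polynomial A) (Polynomial K), r * f = f * s) ↔
      (∀ p : Polynomial A, Polynomial.eval₂ φ ω p = 0 → p = 0)) := by
  let _ : Module (Polynomial A) (Polynomial K) :=
    Module.compHom (Polynomial K)
      ((Polynomial.C : K →+* Polynomial K).comp (Polynomial.eval₂RingHom φ ω))
  let _ : Module (Polynomial A)ᵐᵒᵖ (Polynomial K) :=
    Module.compHom (Polynomial K)
      ((Polynomial.mapRingHom π).fromOpposite fun _ _ => mul_comm _ _)
  exact trivSqZeroExt_rightDuo_iff_eval₂_injective hπ φ ω (fun _ _ => rfl) (fun _ _ => rfl)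
end

section
/- Let A be a commutative domain, P a maximal ideal of A, K = A⧸P with quotient map π : A → K, φ : A →+* K an injective ring homomorphism, ω ∈ K, and T_ω = TrivSqZeroExt A[X] K[X] with multiplication (p,q)*(p',q') = (p*p', C(φ_ω(p))*q' + q*π̄(p')), where φ_ω = Polynomial.eval₂ φ ω and π̄ = Polynomial.map π. Let n ∈ ℕ and assume that every nonzero p ∈ A[X] with φ_ω(p) = 0 has natDegree strictly greater than n. Then for every f = (p,q) ∈ T_ω with p.natDegree ≤ n, the principal right ideal {f*t | t ∈ T_ω} is a two-sided ideal of T_ω. -/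
/-- **Ore extensions over duo rings** (Matczuk), Corollary 4.5(2)(a).
`T_ω = TrivSqZeroExt A[X] K[X]` with actions `p • q = C (eval₂ φ ω p) * q` and
`q • p = q * map π p`.  If every nonzero `p ∈ A[X]` with `eval₂ φ ω p = 0` has
`natDegree` greater than `n`, then for every `f = (p, q)` with `p.natDegree ≤ n`,
the principal right ideal `f * T_ω` is a two-sided ideal of `T_ω`. -/
theorem principal_right_ideal_twoSided_of_natDegree_le
    {A K : Type*} [CommRing A] [IsDomain A] [Field K]
    (P : Ideal A) [P.IsMaximal] (π : A →+* K) (hπ : Function.Surjective π)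
    (hker : RingHom.ker π = P) (φ : A →+* K) (hφ : Function.Injective φ)
    (ω : K) (n : ℕ)
    (hdeg : ∀ p : Polynomial A, p ≠ 0 → Polynomial.eval₂ φ ω p = 0 → n < p.natDegree) :
    letI : Module (Polynomial A) (Polynomial K) :=
      Module.compHom (Polynomial K)
        ((Polynomial.C : K →+* Polynomial K).comp (Polynomial.eval₂RingHom φ ω))
    letI : Module (Polynomial A)ᵐᵒᵖ (Polynomial K) :=
      Module.compHom (Polynomial K)
        ((Polynomial.mapRingHom π).fromOpposite fun _ _ => mul_comm _ _)
    letI : SMulCommClass (Polynomial A) (Polynomial A)ᵐᵒᵖ (Polynomial K) :=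
      ⟨fun _ _ _ => mul_left_comm _ _ _⟩
    ∀ (p : Polynomial A) (q : Polynomial K), p.natDegree ≤ n →
      ∀ g y : TrivSqZeroExt (Polynomial A) (Polynomial K),
        (∃ t, y = tszeMk p q * t) → ∃ t, g * y = tszeMk p q * t := by
  intro p q hp g y
  rintro ⟨t, rfl⟩
  obtain ⟨a, b⟩ := g
  obtain ⟨p', q'⟩ := t
  by_cases h0 : p = 0
  · subst h0
    obtain ⟨c, hc⟩ := hπ (Polynomial.eval₂ φ ω a)
    refine ⟨tszeMk (Polynomial.C c * p') 0, Prod.ext ?_ ?_⟩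
    · change a * (0 * p') = 0 * (Polynomial.C c * p')
      ring
    · change Polynomial.C (Polynomial.eval₂ φ ω a) *
            (Polynomial.C (Polynomial.eval₂ φ ω 0) * q' + Polynomial.map π p' * q) +
            Polynomial.map π (0 * p') * b =
          Polynomial.C (Polynomial.eval₂ φ ω 0) * 0 +
            Polynomial.map π (Polynomial.C c * p') * q
      simp [hc, mul_assoc]
  · have hne : Polynomial.eval₂ φ ω p ≠ 0 := fun h => (hdeg p h0 h).not_ge hp
    have hinv : Polynomial.C (Polynomial.eval₂ φ ω p) *
        Polynomial.C (Polynomial.eval₂ φ ω p)⁻¹ = 1 := by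
      rw [← Polynomial.C_mul, mul_inv_cancel₀ hne, Polynomial.C_1]
    refine ⟨tszeMk (a * p') (Polynomial.C (Polynomial.eval₂ φ ω p)⁻¹ *
      (Polynomial.C (Polynomial.eval₂ φ ω a) *
        (Polynomial.C (Polynomial.eval₂ φ ω p) * q' + Polynomial.map π p' * q) +
        Polynomial.map π (p * p') * b - Polynomial.map π (a * p') * q)), Prod.ext ?_ ?_⟩
    · change a * (p * p') = p * (a * p')
      ring
    · change Polynomial.C (Polynomial.eval₂ φ ω a) *
            (Polynomial.C (Polynomial.eval₂ φ ω p) * q' + Polynomial.map π p' * q) +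
            Polynomial.map π (p * p') * b =
          Polynomial.C (Polynomial.eval₂ φ ω p) * (Polynomial.C (Polynomial.eval₂ φ ω p)⁻¹ * _) +
            Polynomial.map π (a * p') * q
      rw [← mul_assoc (Polynomial.C (Polynomial.eval₂ φ ω p)), hinv, one_mul, sub_add_cancel]
end

section
/- Let K be a field, φ : K →+* K a ring endomorphism of K, and ω ∈ K. Let T_ω = TrivSqZeroExt K[X] K[X] with multiplication (p,q)*(p',q') = (p*p', C(eval₂ φ ω p)*q' + q*p'). Then for f = (p,q) ∈ T_ω, the principal right ideal {f*t | t ∈ T_ω} is a two-sided ideal of T_ω if and only if Polynomial.eval₂ φ ω p ≠ 0 or p = 0. -/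
/-- A copy of the polynomial ring `K[X]`, used as the module part of the square-zero
extension `T_ω = K[X] ⊕ K[X]` (so that its twisted `K[X]`-bimodule structure does not
clash with the canonical self-action of `K[X]`). -/
def PolyV (K : Type*) [Semiring K] : Type _ := Polynomial K

noncomputable instance {K : Type*} [Field K] : AddCommGroup (PolyV K) :=
  inferInstanceAs (AddCommGroup (Polynomial K))

/-- The identification of `K[X]` with its copy `PolyV K`. -/
def PolyV.of {K : Type*} [Semiring K] : Polynomial K → PolyV K := id

/-- **Ore extensions over duo rings** (Matczuk), Corollary 4.6.
Let `K` be a field, `φ : K →+* K` a ring endomorphism and `ω ∈ K`.  In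
`T_ω = TrivSqZeroExt K[X] K[X]` with multiplication
`(p, q) * (p', q') = (p * p', C (eval₂ φ ω p) * q' + q * p')` (the case `P = 0`,
`A = K`), the principal right ideal generated by `f = (p, q)` is a two-sided ideal
iff `eval₂ φ ω p ≠ 0` or `p = 0`. -/
theorem principal_right_ideal_twoSided_iff_field_case
    {K : Type*} [Field K] (φ : K →+* K) (ω : K) :
    letI : Module (Polynomial K) (PolyV K) :=
      Module.compHom (Polynomial K)
        ((Polynomial.C : K →+* Polynomial K).comp (Polynomial.eval₂RingHom φ ω))
    letI : Module (Polynomial K)ᵐᵒᵖ (PolyV K) :=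
      Module.compHom (Polynomial K)
        ((RingHom.id (Polynomial K)).fromOpposite fun _ _ => mul_comm _ _)
    letI : SMulCommClass (Polynomial K) (Polynomial K)ᵐᵒᵖ (PolyV K) :=
      ⟨fun _ _ _ => mul_left_comm (G := Polynomial K) _ _ _⟩
    (∀ p p' q q' : Polynomial K,
      tszeMk p (PolyV.of q) * tszeMk p' (PolyV.of q') =
        tszeMk (p * p')
          (PolyV.of (Polynomial.C (Polynomial.eval₂ φ ω p) * q' + q * p'))) ∧
    (∀ p q : Polynomial K,
      ((∀ g y : TrivSqZeroExt (Polynomial K) (PolyV K),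
          (∃ t, y = tszeMk p (PolyV.of q) * t) →
            ∃ t, g * y = tszeMk p (PolyV.of q) * t) ↔
        (Polynomial.eval₂ φ ω p ≠ 0 ∨ p = 0))) := by
  let _ : Module (Polynomial K) (PolyV K) :=
    Module.compHom (Polynomial K)
      ((Polynomial.C : K →+* Polynomial K).comp (Polynomial.eval₂RingHom φ ω))
  let _ : Module (Polynomial K)ᵐᵒᵖ (PolyV K) :=
    Module.compHom (Polynomial K)
      ((RingHom.id (Polynomial K)).fromOpposite fun _ _ => mul_comm _ _)
  let _ : SMulCommClass (Polynomial K) (Polynomial K)ᵐᵒᵖ (PolyV K) :=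
    ⟨fun _ _ _ => mul_left_comm (G := Polynomial K) _ _ _⟩
  have hmul : ∀ p p' q q' : Polynomial K,
      tszeMk p (PolyV.of q) * tszeMk p' (PolyV.of q') =
        tszeMk (p * p')
          (PolyV.of (Polynomial.C (Polynomial.eval₂ φ ω p) * q' + q * p')) := by
    intro p p' q q'
    rw [mul_comm q p']
    rfl
  have hsurj : ∀ x : TrivSqZeroExt (Polynomial K) (PolyV K),
      ∃ a b : Polynomial K, x = tszeMk a (PolyV.of b) := fun x => ⟨x.1, x.2, rfl⟩
  refine ⟨hmul, fun p q => ⟨fun h => ?_, fun h => ?_⟩⟩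
  · by_contra! hp
    obtain ⟨he, hp⟩ := hp
    obtain ⟨t, ht⟩ := h (tszeMk 0 (PolyV.of 1)) (tszeMk p (PolyV.of q) * tszeMk 1 (PolyV.of 0))
      ⟨_, rfl⟩
    obtain ⟨s, r, rfl⟩ := hsurj t
    simp only [hmul, he, map_zero, zero_mul, zero_add, mul_one, mul_zero, one_mul,
      Polynomial.eval₂_zero] at ht
    have h₁ : 0 = p * s := congrArg Prod.fst ht
    have h₂ : p = q * s := congrArg Prod.snd ht
    have hs : s = 0 := by simpa [hp] using h₁.symm
    exact hp (by rw [h₂, hs, mul_zero])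
  · rintro g _ ⟨t, rfl⟩
    obtain ⟨a, b, rfl⟩ := hsurj g
    obtain ⟨s, r, rfl⟩ := hsurj t
    simp only [hmul]
    obtain he | rfl := h
    · generalize Polynomial.C (Polynomial.eval₂ φ ω a) *
        (Polynomial.C (Polynomial.eval₂ φ ω p) * r + q * s) + b * (p * s) = v
      refine ⟨tszeMk (a * s) (PolyV.of
        (Polynomial.C (Polynomial.eval₂ φ ω p)⁻¹ * (v - q * (a * s)))), ?_⟩
      rw [hmul, ← mul_assoc (Polynomial.C _), ← Polynomial.C_mul, mul_inv_cancel₀ he, map_one,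
        one_mul, sub_add_cancel, mul_left_comm]
    · refine ⟨tszeMk (Polynomial.C (Polynomial.eval₂ φ ω a) * s) (PolyV.of 0), ?_⟩
      rw [hmul]
      simp [mul_left_comm]
end

section
/- Let A be a commutative domain, P a maximal ideal of A, K = A⧸P with quotient map π : A → K, φ : A →+* K an injective ring homomorphism, ω ∈ K, and T_ω = TrivSqZeroExt A[X] K[X] with multiplication (p,q)*(p',q') = (p*p', C(φ_ω(p))*q' + q*π̄(p')), where φ_ω = Polynomial.eval₂ φ ω and π̄ = Polynomial.map π. Then T_ω is quasi-duo: every maximal right ideal of T_ω is a two-sided ideal (if I is a maximal right ideal, then t*r ∈ I for all r ∈ I and t ∈ T_ω), and likewise every maximal left ideal of T_ω is a two-sided ideal. -/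
section SquareZeroKernel

variable {T S : Type*} [Ring T] [CommRing S] (f : T →+* S)

/-- A maximal left ideal contains every ideal whose elements square to zero. -/
theorem mem_of_isCoatom_of_map_eq_zero (hf : ∀ x, f x = 0 → x * x = 0)
    {I : Ideal T} (hI : IsCoatom I) {n : T} (hn : f n = 0) : n ∈ I := by
  by_contra h
  have h1 : (1 : T) ∈ I ⊔ Ideal.span {n} := by
    rw [hI.2 _ (left_lt_sup.2 fun hle => h (hle (Ideal.mem_span_singleton_self n)))]
    trivial
  obtain ⟨i, hi, y, hy, hiy⟩ := Submodule.mem_sup.1 h1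
  obtain ⟨a, rfl⟩ := Ideal.mem_span_singleton'.1 hy
  have hsq := hf (a * n) (by simp [hn])
  refine hI.1 ((Ideal.eq_top_iff_one I).2 ?_)
  convert I.mul_mem_left (1 + a * n) hi using 1
  rw [eq_sub_of_add_eq hiy, add_mul, one_mul, mul_sub, mul_one, hsq]
  abel

/-- A maximal right ideal contains every ideal whose elements square to zero. -/
theorem mem_of_isCoatom_of_map_eq_zero_right (hf : ∀ x, f x = 0 → x * x = 0)
    {I : Submodule Tᵐᵒᵖ T} (hI : IsCoatom I) {n : T} (hn : f n = 0) : n ∈ I := by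
  by_contra h
  have h1 : (1 : T) ∈ I ⊔ Submodule.span Tᵐᵒᵖ {n} := by
    rw [hI.2 _ (left_lt_sup.2 fun hle => h (hle (Submodule.mem_span_singleton_self n)))]
    trivial
  obtain ⟨i, hi, y, hy, hiy⟩ := Submodule.mem_sup.1 h1
  obtain ⟨a, rfl⟩ := Submodule.mem_span_singleton.1 hy
  have hsq := hf (n * a.unop) (by simp [hn])
  have hone : (1 : T) ∈ I := by
    convert I.smul_mem (MulOpposite.op (1 + n * a.unop)) hi using 1
    rw [op_smul_eq_mul, eq_sub_of_add_eq hiy, ← MulOpposite.op_unop a,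
      op_smul_eq_mul, MulOpposite.unop_op, sub_mul, one_mul, mul_add, mul_one, hsq]
    abel
  refine hI.1 (eq_top_iff.2 fun x _ => ?_)
  simpa using I.smul_mem (MulOpposite.op x) hone

/-- A ring with a homomorphism to a commutative ring whose kernel consists of elements squaring
to zero is quasi-duo. -/
theorem quasiDuo_of_map_eq_zero (hf : ∀ x, f x = 0 → x * x = 0) :
    (∀ I : Submodule Tᵐᵒᵖ T, IsCoatom I → ∀ r ∈ I, ∀ t : T, t * r ∈ I) ∧
    (∀ I : Ideal T, IsCoatom I → ∀ r ∈ I, ∀ t : T, r * t ∈ I) := by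
  refine ⟨fun I hI r hr t => ?_, fun I hI r hr t => ?_⟩
  · have hcomm : t * r - r * t ∈ I :=
      mem_of_isCoatom_of_map_eq_zero_right f hf hI (by simp [mul_comm])
    simpa using I.add_mem hcomm (I.smul_mem (MulOpposite.op t) hr)
  · have hcomm : r * t - t * r ∈ I :=
      mem_of_isCoatom_of_map_eq_zero f hf hI (by simp [mul_comm])
    simpa using I.add_mem hcomm (I.mul_mem_left t hr)

end SquareZeroKernel

/-- A trivial square-zero extension of a commutative ring by a bimodule is quasi-duo. -/
theorem TrivSqZeroExt.quasiDuo {R M : Type*} [CommRing R] [AddCommGroup M] [Module R M]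
    [Module Rᵐᵒᵖ M] [SMulCommClass R Rᵐᵒᵖ M] :
    (∀ I : Submodule (TrivSqZeroExt R M)ᵐᵒᵖ (TrivSqZeroExt R M),
      IsCoatom I → ∀ r ∈ I, ∀ t : TrivSqZeroExt R M, t * r ∈ I) ∧
    (∀ I : Ideal (TrivSqZeroExt R M),
      IsCoatom I → ∀ r ∈ I, ∀ t : TrivSqZeroExt R M, r * t ∈ I) := by
  let f : TrivSqZeroExt R M →+* R :=
    { toFun := TrivSqZeroExt.fst
      map_one' := TrivSqZeroExt.fst_one
      map_mul' := TrivSqZeroExt.fst_mul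
      map_zero' := TrivSqZeroExt.fst_zero
      map_add' := TrivSqZeroExt.fst_add }
  refine quasiDuo_of_map_eq_zero f fun x hx => ?_
  have hx : x.fst = 0 := hx
  ext <;> simp [hx]


/-- **Ore extensions over duo rings** (Matczuk), Theorem 4.7(1).
`T_ω = TrivSqZeroExt A[X] K[X]` with actions `p • q = C (eval₂ φ ω p) * q` and
`q • p = q * map π p` (ring-isomorphic to the Ore extension `R[x; σ, δ_ω]`) is a
quasi-duo ring: every maximal right ideal and every maximal left ideal is a
two-sided ideal. -/
theorem tOmega_quasiDuo
    {A K : Type*} [CommRing A] [IsDomain A] [Field K]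
    (P : Ideal A) [P.IsMaximal] (π : A →+* K) (hπ : Function.Surjective π)
    (hker : RingHom.ker π = P) (φ : A →+* K) (hφ : Function.Injective φ)
    (ω : K) :
    letI : Module (Polynomial A) (Polynomial K) :=
      Module.compHom (Polynomial K)
        ((Polynomial.C : K →+* Polynomial K).comp (Polynomial.eval₂RingHom φ ω))
    letI : Module (Polynomial A)ᵐᵒᵖ (Polynomial K) :=
      Module.compHom (Polynomial K)
        ((Polynomial.mapRingHom π).fromOpposite fun _ _ => mul_comm _ _)
    letI : SMulCommClass (Polynomial A) (Polynomial A)ᵐᵒᵖ (Polynomial K) :=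
      ⟨fun _ _ _ => mul_left_comm _ _ _⟩
    (∀ I : Submodule (TrivSqZeroExt (Polynomial A) (Polynomial K))ᵐᵒᵖ
        (TrivSqZeroExt (Polynomial A) (Polynomial K)),
      IsCoatom I → ∀ r ∈ I, ∀ t : TrivSqZeroExt (Polynomial A) (Polynomial K),
        t * r ∈ I) ∧
    (∀ I : Ideal (TrivSqZeroExt (Polynomial A) (Polynomial K)),
      IsCoatom I → ∀ r ∈ I, ∀ t : TrivSqZeroExt (Polynomial A) (Polynomial K),
        r * t ∈ I) := by
  let : Module (Polynomial A) (Polynomial K) :=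
    Module.compHom (Polynomial K)
      ((Polynomial.C : K →+* Polynomial K).comp (Polynomial.eval₂RingHom φ ω))
  let : Module (Polynomial A)ᵐᵒᵖ (Polynomial K) :=
    Module.compHom (Polynomial K)
      ((Polynomial.mapRingHom π).fromOpposite fun _ _ => mul_comm _ _)
  let : SMulCommClass (Polynomial A) (Polynomial A)ᵐᵒᵖ (Polynomial K) :=
    ⟨fun _ _ _ => mul_left_comm _ _ _⟩
  exact TrivSqZeroExt.quasiDuo
end
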